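/- arXiv:2411.08004 — 2 statements merged into one kernel-verified Lean document; each statement's English description precedes it below -/
import Mathlib

section
/- Let R be a ring and let S be a left denominator set of R with ass_l(S) = 0 such that S⁻¹R is a semisimple Artinian ring. Then the set C_R of regular elements of R is a left denominator set of R with ass_l(C_R) = 0, and the classical left quotient ring Q_l(R) = C_R⁻¹R is R-isomorphic to S⁻¹R. -/
/-- A two-sided ideal `I` of a ring is nilpotent if for some `n ≥ 1` every product of
`n` elements of `I` vanishes. -/
def TwoSidedIdeal.IsNilpotentIdeal {R : Type*} [Ring R] (I : TwoSidedIdeal R) : Prop :=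
  ∃ n : ℕ, 0 < n ∧ ∀ f : Fin n → R, (∀ i, f i ∈ I) → (List.ofFn f).prod = 0

/-- A ring is semiprime if it has no nonzero nilpotent two-sided ideal. -/
def IsSemiprimeRing' (R : Type*) [Ring R] : Prop :=
  ∀ I : TwoSidedIdeal R, I.IsNilpotentIdeal → I = ⊥

/-- A ring has finite left uniform dimension if it contains no infinite direct sum of
nonzero left ideals. -/
def HasFiniteLeftUniformDimension (R : Type*) [Ring R] : Prop :=
  ¬ ∃ f : ℕ → Ideal R, (∀ n, f n ≠ ⊥) ∧ iSupIndep f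

/-- The left annihilator of a subset `S` of a ring. -/
def leftAnnihilator (R : Type*) [Ring R] (S : Set R) : Set R :=
  {r : R | ∀ s ∈ S, r * s = 0}

/-- The ascending chain condition on left annihilators. -/
def ACCLeftAnnihilators (R : Type*) [Ring R] : Prop :=
  ∀ f : ℕ → Set R, (∀ n, ∃ S : Set R, f n = leftAnnihilator R S) → Monotone f →
    ∃ N, ∀ n, N ≤ n → f n = f N

/-- A ring is a left Goldie ring if it has finite left uniform dimension and satisfies
the a.c.c. on left annihilators. -/
def IsLeftGoldieRing (R : Type*) [Ring R] : Prop :=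
  HasFiniteLeftUniformDimension R ∧ ACCLeftAnnihilators R

/-- A left ideal is essential if it meets every nonzero left ideal nontrivially. -/
def IsEssentialLeftIdeal {R : Type*} [Ring R] (I : Ideal R) : Prop :=
  ∀ J : Ideal R, J ≠ ⊥ → I ⊓ J ≠ ⊥

/-- A ring endomorphism has large image if its image contains an essential left ideal. -/
def HasLargeImage {R : Type*} [Ring R] (σ : R →+* R) : Prop :=
  ∃ I : Ideal R, IsEssentialLeftIdeal I ∧ (I : Set R) ⊆ Set.range σ

/-- The left uniform dimension of a module, with values in `ℕ∞`: the supremum of the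
numbers `k` such that `M` contains a direct sum of `k` nonzero submodules. -/
noncomputable def udim (R : Type*) [Ring R] (M : Type*) [AddCommGroup M] [Module R M] : ℕ∞ :=
  sSup {n : ℕ∞ | ∃ (k : ℕ) (f : Fin k → Submodule R M),
    n = (k : ℕ∞) ∧ (∀ i, f i ≠ ⊥) ∧ iSupIndep f}

/-- `DevLE α P` means that the deviation of the poset `P` is at most the ordinal `α`:
for every descending chain, all but finitely many of its factor intervals either are
trivial or have deviation at most some ordinal `β < α`. -/
def DevLE (α : Ordinal.{v}) (P : Type u) [Preorder P] : Prop :=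
  ∀ f : ℕ → P, (∀ n, f (n + 1) ≤ f n) →
    ∃ N : ℕ, ∀ n, N ≤ n →
      (∀ x y : Set.Icc (f (n + 1)) (f n), x ≤ y → y ≤ x) ∨
      ∃ (β : Ordinal.{v}) (_ : β < α), DevLE β (Set.Icc (f (n + 1)) (f n))
termination_by α

/-- A module has (Gabriel–Rentschler) Krull dimension if the deviation of its lattice of
submodules is defined, i.e. bounded by some ordinal. -/
def HasKrullDimGR (R : Type u) [Ring R] (M : Type v) [AddCommGroup M] [Module R M] : Prop :=
  ∃ α : Ordinal.{max u v}, DevLE α (Submodule R M)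

/-- The Gabriel–Rentschler Krull dimension of a module: the least ordinal bounding the
deviation of its lattice of submodules. -/
noncomputable def krullDimGR (R : Type u) [Ring R] (M : Type v) [AddCommGroup M]
    [Module R M] : Ordinal.{max u v} :=
  sInf {α : Ordinal.{max u v} | DevLE α (Submodule R M)}

section Ore

variable {R : Type*} [Ring R]

/-- A multiplicative subset: contains `1`, omits `0` and is closed under multiplication. -/
def IsMultSet (S : Set R) : Prop :=
  1 ∈ S ∧ 0 ∉ S ∧ ∀ s ∈ S, ∀ t ∈ S, s * t ∈ S

/-- A left Ore set: a multiplicative set satisfying the left Ore condition. -/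
def IsLeftOreSet (S : Set R) : Prop :=
  IsMultSet S ∧ ∀ (r : R), ∀ s ∈ S, ∃ s' ∈ S, ∃ r' : R, s' * r = r' * s

/-- `assL S = { r | s r = 0 for some s ∈ S }`. -/
def assL (S : Set R) : Set R := {r : R | ∃ s ∈ S, s * r = 0}

/-- A left denominator set: a left Ore set such that `r s = 0` with `s ∈ S` implies
`t r = 0` for some `t ∈ S`. -/
def IsLeftDenominatorSet (S : Set R) : Prop :=
  IsLeftOreSet S ∧ ∀ (r : R), ∀ s ∈ S, r * s = 0 → ∃ t ∈ S, t * r = 0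

/-- `θ : R →+* Q` realizes `Q` as the left localization `S⁻¹R` of `R` at `S`:
elements of `S` become units, the kernel of `θ` is `assL S`, and every element of `Q`
has the form `θ(s)⁻¹ θ(r)`. -/
structure IsLeftLocalization {Q : Type*} [Ring Q] (S : Set R) (θ : R →+* Q) : Prop where
  isUnit : ∀ s ∈ S, IsUnit (θ s)
  ker_eq : ∀ r : R, θ r = 0 ↔ r ∈ assL S
  exists_rep : ∀ q : Q, ∃ s ∈ S, ∃ r : R, θ s * q = θ r

end Ore

section Localization

variable {R : Type*} [Ring R] {S : Set R}

/-- If `q'` in the localization is represented by the fractions `s⁻¹ r` and `t⁻¹ p`, then these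
two fractions also agree in every ring in which `S` becomes invertible. -/
theorem IsLeftLocalization.fraction_unique {Q' Q : Type*} [Ring Q'] [Ring Q] {θ' : R →+* Q'}
    {θ : R →+* Q} (hS : IsLeftOreSet S) (h' : IsLeftLocalization S θ')
    (hu : ∀ s ∈ S, IsUnit (θ s)) {q' : Q'} {q₁ q₂ : Q} {s t r p : R} (hs : s ∈ S) (ht : t ∈ S)
    (hs' : θ' s * q' = θ' r) (hs₁ : θ s * q₁ = θ r) (ht' : θ' t * q' = θ' p)
    (ht₂ : θ t * q₂ = θ p) : q₁ = q₂ := by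
  obtain ⟨a, ha, b, hab⟩ := hS.2 t s hs
  have hz : θ' (a * p - b * r) = 0 := by
    rw [map_sub, map_mul, map_mul, ← ht', ← hs', ← mul_assoc, ← mul_assoc, ← map_mul, ← map_mul,
      hab, sub_self]
  obtain ⟨u, hu', huz⟩ := (h'.ker_eq _).1 hz
  have hz₂ : θ (a * p - b * r) = 0 := by
    apply (hu u hu').mul_left_cancel
    rw [← map_mul, huz, map_zero, mul_zero]
  rw [map_sub, sub_eq_zero, map_mul, map_mul] at hz₂
  apply (hu t ht).mul_left_cancel
  apply (hu a ha).mul_left_cancel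
  rw [ht₂, hz₂, ← hs₁, ← mul_assoc, ← mul_assoc, ← map_mul, ← map_mul, hab]

/-- The universal property of the left localization at a left Ore set. -/
theorem IsLeftLocalization.exists_lift {Q' Q : Type*} [Ring Q'] [Ring Q] {θ' : R →+* Q'}
    {θ : R →+* Q} (hS : IsLeftOreSet S) (h' : IsLeftLocalization S θ')
    (hu : ∀ s ∈ S, IsUnit (θ s)) : ∃ f : Q' →+* Q, ∀ r, f (θ' r) = θ r := by
  have hex : ∀ q' : Q', ∃ q : Q, ∃ s ∈ S, ∃ r : R, θ' s * q' = θ' r ∧ θ s * q = θ r := by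
    intro q'
    obtain ⟨s, hs, r, hr⟩ := h'.exists_rep q'
    obtain ⟨u, hu⟩ := hu s hs
    exact ⟨↑u⁻¹ * θ r, s, hs, r, hr, by rw [← hu, Units.mul_inv_cancel_left]⟩
  choose f s hs r hr' hr using hex
  have key : ∀ (q' : Q') (q : Q) (t : R), t ∈ S → ∀ p : R, θ' t * q' = θ' p → θ t * q = θ p →
      f q' = q := fun q' q t ht p h₁ h₂ =>
    h'.fraction_unique hS hu (hs q') ht (hr' q') (hr q') h₁ h₂
  have hθ : ∀ a, f (θ' a) = θ a := fun a =>
    key _ _ 1 hS.1.1 a (by simp) (by simp)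
  refine ⟨{ toFun := f, map_one' := ?_, map_zero' := ?_, map_add' := ?_, map_mul' := ?_ }, hθ⟩
  · simpa using hθ 1
  · intro x y
    obtain ⟨a, ha, b, hab⟩ := hS.2 (r x) (s y) (hs y)
    refine key _ _ (a * s x) (hS.1.2.2 a ha _ (hs x)) (b * r y) ?_ ?_
    · rw [map_mul, mul_assoc, ← mul_assoc (θ' (s x)), hr' x, ← mul_assoc, ← map_mul, hab, map_mul,
        mul_assoc, hr' y, ← map_mul]
    · rw [map_mul, mul_assoc, ← mul_assoc (θ (s x)), hr x, ← mul_assoc, ← map_mul, hab, map_mul,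
        mul_assoc, hr y, ← map_mul]
  · simpa using hθ 0
  · intro x y
    obtain ⟨a, ha, b, hab⟩ := hS.2 (s x) (s y) (hs y)
    refine key _ _ (a * s x) (hS.1.2.2 a ha _ (hs x)) (a * r x + b * r y) ?_ ?_
    · rw [mul_add, map_add]
      nth_rewrite 2 [hab]
      simp only [map_mul, mul_assoc, hr']
    · rw [mul_add, map_add]
      nth_rewrite 2 [hab]
      simp only [map_mul, mul_assoc, hr]

/-- Left localizations at a left Ore set are unique up to isomorphism over the base ring. -/
theorem IsLeftLocalization.exists_ringEquiv {Q' Q : Type*} [Ring Q'] [Ring Q] {θ' : R →+* Q'}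
    {θ : R →+* Q} (hS : IsLeftOreSet S) (h' : IsLeftLocalization S θ')
    (h : IsLeftLocalization S θ) : ∃ e : Q' ≃+* Q, ∀ r, e (θ' r) = θ r := by
  obtain ⟨f, hf⟩ := h'.exists_lift hS h.isUnit
  refine ⟨RingEquiv.ofBijective f ⟨?_, ?_⟩, hf⟩
  · rw [injective_iff_map_eq_zero]
    intro q' hq
    obtain ⟨s, hs, r, hr⟩ := h'.exists_rep q'
    have hz : θ r = 0 := by rw [← hf, ← hr, map_mul, hq, mul_zero]
    have hz' : θ' r = 0 := (h'.ker_eq r).2 ((h.ker_eq r).1 hz)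
    apply (h'.isUnit s hs).mul_left_cancel
    rw [hr, hz', mul_zero]
  · intro q
    obtain ⟨s, hs, r, hr⟩ := h.exists_rep q
    obtain ⟨u, hu⟩ := h'.isUnit s hs
    refine ⟨↑u⁻¹ * θ' r, (h.isUnit s hs).mul_left_cancel ?_⟩
    rw [hr, ← hf, ← hf, ← map_mul, ← hu, Units.mul_inv_cancel_left]

/-- In a left Artinian ring every right regular element is a unit. -/
theorem IsRightRegular.isUnit_of_isArtinianRing {Q : Type*} [Ring Q] [IsArtinianRing Q] {x : Q}
    (hx : IsRightRegular x) : IsUnit x := by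
  have hinj : Function.Injective (LinearMap.toSpanSingleton Q Q x) := fun a b hab => by
    simp only [LinearMap.toSpanSingleton_apply, smul_eq_mul] at hab
    exact hx hab
  obtain ⟨u, hu⟩ := IsArtinian.surjective_of_injective_endomorphism _ hinj 1
  rw [LinearMap.toSpanSingleton_apply, smul_eq_mul] at hu
  have hu' : x * u = 1 := hx (by
    change x * u * x = 1 * x
    rw [mul_assoc, hu, mul_one, one_mul])
  exact ⟨⟨x, u, hu', hu⟩, rfl⟩

/-- If the left localization at `S` is faithful and left Artinian, then regular elements become
units in it. -/
theorem IsLeftLocalization.isUnit_of_isRegular {Q : Type*} [Ring Q] [IsArtinianRing Q]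
    {θ : R →+* Q} (h : IsLeftLocalization S θ) (hθ : Function.Injective θ) {c : R}
    (hc : IsRegular c) : IsUnit (θ c) := by
  apply IsRightRegular.isUnit_of_isArtinianRing
  intro a b hab
  rw [← sub_eq_zero]
  generalize hq' : a - b = q
  have hq : q * θ c = 0 := by
    rw [← hq', sub_mul, sub_eq_zero]
    exact hab
  obtain ⟨s, hs, r, hr⟩ := h.exists_rep q
  have hrc : r * c = 0 := hθ (by rw [map_mul, ← hr, mul_assoc, hq, mul_zero, map_zero])
  have hr0 : r = 0 := hc.right (by simpa using hrc)
  apply (h.isUnit s hs).mul_left_cancel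
  rw [hr, hr0, map_zero, mul_zero]

end Localization

/-- **Proposition 2.1.(2).** If `S` is a left denominator set of `R` with `assL S = 0`
such that `S⁻¹R` is a semisimple Artinian ring, then the set of regular elements of `R`
is a left denominator set with `assL = 0` and `Q_l(R) = C_R⁻¹R` is `R`-isomorphic to
`S⁻¹R`. -/
theorem classical_quotient_of_semisimple_localization {R : Type u} {Q : Type v}
    [Ring R] [Ring Q] (S : Set R) (hS : IsLeftDenominatorSet S) (ha : assL S = {0})
    (θ : R →+* Q) (hloc : IsLeftLocalization S θ) (hss : IsSemisimpleRing Q) :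
    IsLeftDenominatorSet {r : R | IsRegular r} ∧ assL {r : R | IsRegular r} = {0} ∧
      IsLeftLocalization {r : R | IsRegular r} θ ∧
      ∀ (Q' : Type w) [Ring Q'] (θ' : R →+* Q'),
        IsLeftLocalization {r : R | IsRegular r} θ' →
          ∃ e : Q' ≃+* Q, ∀ r : R, e (θ' r) = θ r := by
  have hinj : Function.Injective θ := by
    rw [injective_iff_map_eq_zero]
    intro r hr
    simpa [ha] using (hloc.ker_eq r).1 hr
  have hreg : ∀ s ∈ S, IsRegular s := fun s hs =>
    ⟨fun a b hab => hinj ((hloc.isUnit s hs).mul_left_cancel (by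
      simpa only [map_mul] using congrArg θ hab)),
     fun a b hab => hinj ((hloc.isUnit s hs).mul_right_cancel (by
      simpa only [map_mul] using congrArg θ hab))⟩
  have hunit : ∀ c : R, IsRegular c → IsUnit (θ c) := fun c hc =>
    hloc.isUnit_of_isRegular hinj hc
  have hne : (1 : R) ≠ 0 := fun h0 => hS.1.1.2.1 (h0 ▸ hS.1.1.1)
  have hass : assL {r : R | IsRegular r} = {0} := by
    ext r
    constructor
    · rintro ⟨c, hc, hcr⟩
      exact hc.left (by simpa using hcr)
    · rintro rfl
      exact ⟨1, isRegular_one, mul_zero 1⟩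
  have hore : IsLeftOreSet {r : R | IsRegular r} := by
    refine ⟨⟨isRegular_one, fun h0 => hne (h0.left (by simp)), fun s hs t ht => hs.mul ht⟩, ?_⟩
    intro r c hc
    obtain ⟨u, hu⟩ := hunit c hc
    obtain ⟨s, hs, r', hr'⟩ := hloc.exists_rep (θ r * ↑u⁻¹)
    refine ⟨s, hreg s hs, r', hinj ?_⟩
    rw [map_mul, map_mul, ← hr', ← hu, mul_assoc, Units.inv_mul_cancel_right]
  have hC : IsLeftLocalization {r : R | IsRegular r} θ := by
    refine ⟨hunit, fun r => ?_, fun q => ?_⟩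
    · rw [hass, Set.mem_singleton_iff, map_eq_zero_iff θ hinj]
    · obtain ⟨s, hs, r, hr⟩ := hloc.exists_rep q
      exact ⟨s, hreg s hs, r, hr⟩
  refine ⟨⟨hore, fun r c hc hrc => ⟨1, isRegular_one, ?_⟩⟩, hass, hC, fun Q' _ θ' h' =>
    h'.exists_ringEquiv hore hC⟩
  rw [one_mul]
  exact hc.right (by simpa using hrc)
end

section
/- Let R be a semiprime left Goldie ring with classical left quotient ring Q_l(R), and let σ be a ring endomorphism of R such that σ(C_R) ⊆ C_R. Then σ extends uniquely to a ring endomorphism of Q_l(R) given by c⁻¹r ↦ σ(c)⁻¹σ(r); this extension is a split epimorphism from Q_l(R) onto the classical left quotient ring Q_l(σ(R)) of σ(R), so that Q_l(R) ≅ ker_{Q_l(R)}(σ) × Q_l(σ(R)) as rings and Q_l(σ(R)) = σ(Q_l(R)). -/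
/-- A sequence of submodules subordinate to a descending filtration, each meeting the next
step of the filtration trivially, is independent. -/
theorem iSupIndep_of_antitone_filtration {R M : Type*} [Ring R] [AddCommGroup M] [Module R M]
    (I L : ℕ → Submodule R M) (hL : Antitone L) (hIL : ∀ n, I n ≤ L n)
    (hdisj : ∀ n, Disjoint (I n) (L (n + 1))) : iSupIndep I := by
  classical
  apply iSupIndep_of_dfinsupp_lsum_injective
  rw [injective_iff_map_eq_zero]
  intro m hm
  by_contra hne
  have hex : ∃ i, m i ≠ 0 := by
    by_contra! h
    exact hne (DFinsupp.ext h)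
  set i := Nat.find hex with hi
  have hmi : m i ≠ 0 := Nat.find_spec hex
  have hlt : ∀ j < i, m j = 0 := fun j hj => not_not.mp (Nat.find_min hex hj)
  rw [DFinsupp.lsum_apply_apply, DFinsupp.sumAddHom_apply, DFinsupp.sum,
    ← Finset.add_sum_erase _ _ (DFinsupp.mem_support_iff.mpr hmi)] at hm
  have hrest : (∑ x ∈ m.support.erase i, ((I x).subtype (m x))) ∈ L (i + 1) := by
    refine Submodule.sum_mem _ fun j hj => ?_
    rw [Finset.mem_erase, DFinsupp.mem_support_iff] at hj
    have hij : i + 1 ≤ j := by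
      by_contra hcon
      exact hj.2 (hlt j (by omega))
    exact hL hij (hIL j (m j).2)
  have hmem : (m i : M) ∈ L (i + 1) := by
    have : (m i : M) = -(∑ x ∈ m.support.erase i, ((I x).subtype (m x))) :=
      eq_neg_of_add_eq_zero_left hm
    rw [this]
    exact neg_mem hrest
  exact hmi (Subtype.ext (Submodule.disjoint_def.mp (hdisj i) _ (m i).2 hmem))

section Goldie

variable {R : Type*} [Ring R]

theorem IsSemiprimeRing'.eq_zero_of_forall_mul_mul_eq_zero (h : IsSemiprimeRing' R) {b : R}
    (hb : ∀ r, b * r * b = 0) : b = 0 := by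
  let J : TwoSidedIdeal R := TwoSidedIdeal.mk' {x | ∀ r, x * r * b = 0}
    (by simp) (fun hx hy r => by simp [add_mul, hx r, hy r])
    (fun hx r => by simp [hx r])
    (fun hx r => by rw [mul_assoc, mul_assoc, ← mul_assoc _ r, hx, mul_zero])
    (fun {x y} hx r => by rw [mul_assoc x y r]; exact hx _)
  have hJ : TwoSidedIdeal.span {b} ≤ J := by
    rw [TwoSidedIdeal.span_le]
    rintro _ rfl
    exact (TwoSidedIdeal.mem_mk' ..).mpr hb
  let J' : TwoSidedIdeal R :=
    TwoSidedIdeal.mk' {y | ∀ x ∈ TwoSidedIdeal.span {b}, ∀ r, x * r * y = 0}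
    (by simp) (fun hx hy z hz r => by simp [mul_add, hx z hz r, hy z hz r])
    (fun hx z hz r => by simp [hx z hz r])
    (fun {x y} hy z hz r => by rw [← mul_assoc, mul_assoc z]; exact hy z hz _)
    (fun hy z hz r => by rw [← mul_assoc, hy z hz, zero_mul])
  have hJ' : TwoSidedIdeal.span {b} ≤ J' := by
    rw [TwoSidedIdeal.span_le]
    rintro _ rfl
    exact (TwoSidedIdeal.mem_mk' ..).mpr fun x hx => (TwoSidedIdeal.mem_mk' ..).mp (hJ hx)
  have hbot : TwoSidedIdeal.span {b} = ⊥ := by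
    refine h _ ⟨2, two_pos, fun f hf => ?_⟩
    have := (TwoSidedIdeal.mem_mk' ..).mp (hJ' (hf 1)) (f 0) (hf 0) 1
    simpa using this
  have hmem : b ∈ TwoSidedIdeal.span {b} := TwoSidedIdeal.subset_span rfl
  rw [hbot] at hmem
  exact hmem

theorem Ideal.coe_torsionOf_eq_leftAnnihilator (a : R) :
    (Ideal.torsionOf R R a : Set R) = leftAnnihilator R {a} := by
  ext r
  simp [leftAnnihilator]

theorem ACCLeftAnnihilators.wellFoundedGT (h : ACCLeftAnnihilators R) :
    WellFoundedGT (Set.range (Ideal.torsionOf R R)) := by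
  rw [wellFoundedGT_iff_monotone_chain_condition]
  intro a
  obtain ⟨N, hN⟩ := h (fun n => ((a n : Ideal R) : Set R))
    (fun n => by
      obtain ⟨x, hx⟩ := (a n).2
      exact ⟨{x}, by rw [← hx, Ideal.coe_torsionOf_eq_leftAnnihilator]⟩)
    (fun i j hij => a.monotone hij)
  exact ⟨N, fun m hm => Subtype.ext (SetLike.coe_injective (hN m hm).symm)⟩

theorem ACCLeftAnnihilators.exists_maximal (h : ACCLeftAnnihilators R) {T : Set R}
    (hT : T.Nonempty) : ∃ b ∈ T, ∀ c ∈ T, Ideal.torsionOf R R b ≤ Ideal.torsionOf R R c →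
      Ideal.torsionOf R R c ≤ Ideal.torsionOf R R b := by
  have := h.wellFoundedGT
  obtain ⟨b, hb, hmax⟩ := (InvImage.wf
    (fun x : R => (⟨Ideal.torsionOf R R x, x, rfl⟩ : Set.range (Ideal.torsionOf R R)))
    wellFounded_gt).has_min T hT
  refine ⟨b, hb, fun c hc hle => ?_⟩
  by_contra hnle
  exact hmax c hc (lt_of_le_not_ge hle hnle)

/-- Some positive power `b` of `a` has the same left annihilator as `b * b`. -/
theorem ACCLeftAnnihilators.exists_pow (h : ACCLeftAnnihilators R) (a : R) :
    ∃ n : ℕ, ∀ r, r * (a ^ (n + 1) * a ^ (n + 1)) = 0 → r * a ^ (n + 1) = 0 := by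
  obtain ⟨_, ⟨n, rfl⟩, hmax⟩ := h.exists_maximal (Set.range_nonempty fun n : ℕ => a ^ (n + 1))
  refine ⟨n, fun r hr => hmax (a ^ (n + 1) * a ^ (n + 1)) ⟨n + n + 1, ?_⟩ ?_ hr⟩
  · simp only [← pow_add]
    congr 1
    ring
  · intro s hs
    simp only [Ideal.mem_torsionOf_iff, smul_eq_mul] at hs ⊢
    rw [← mul_assoc, hs, zero_mul]

/-- A semiprime ring with a.c.c. on left annihilators has no nonzero nil right ideals. -/
theorem IsSemiprimeRing'.eq_zero_of_nil_right (h : IsSemiprimeRing' R)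
    (hacc : ACCLeftAnnihilators R) {a : R} (ha : ∀ r, IsNilpotent (a * r)) : a = 0 := by
  by_contra hne
  obtain ⟨b, ⟨hb0, s, rfl⟩, hmax⟩ := hacc.exists_maximal
    (T := {b | b ≠ 0 ∧ ∃ r, b = a * r}) ⟨a, hne, 1, by simp⟩
  refine hb0 (h.eq_zero_of_forall_mul_mul_eq_zero fun x => ?_)
  by_cases hx : a * s * x = 0
  · rw [hx, zero_mul]
  have hnil : IsNilpotent (a * s * x) := by rw [mul_assoc]; exact ha _
  have : Nontrivial R := ⟨⟨_, _, hx⟩⟩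
  obtain ⟨k, hk⟩ := Nat.exists_eq_add_of_le'
    (Nat.one_le_iff_ne_zero.mpr (fun h0 => by
      have := pow_nilpotencyClass hnil
      rw [h0, pow_zero] at this
      exact one_ne_zero this) : 1 ≤ nilpotencyClass (a * s * x))
  obtain ⟨j, rfl⟩ : ∃ j, k = j + 1 := by
    refine Nat.exists_eq_succ_of_ne_zero fun h0 => hx ?_
    have := pow_nilpotencyClass hnil
    rwa [hk, h0, zero_add, pow_one] at this
  have hpow : (a * s * x) ^ (j + 1) ≠ 0 := pow_pred_nilpotencyClass hnil |> fun h => by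
    rwa [hk, Nat.add_sub_cancel] at h
  refine hmax ((a * s * x) ^ (j + 1)) ⟨hpow, s * x * (a * s * x) ^ j, ?_⟩ ?_ ?_
  · rw [pow_succ']
    simp only [mul_assoc]
  · intro r hr
    simp only [Ideal.mem_torsionOf_iff, smul_eq_mul] at hr ⊢
    rw [pow_succ', ← mul_assoc, ← mul_assoc, hr, zero_mul, zero_mul]
  · simp only [Ideal.mem_torsionOf_iff, smul_eq_mul]
    exact (pow_succ' (a * s * x) (j + 1)).symm.trans (hk ▸ pow_nilpotencyClass hnil)

/-- A semiprime ring with a.c.c. on left annihilators has no nonzero nil left ideals. -/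
theorem IsSemiprimeRing'.eq_zero_of_nil_left (h : IsSemiprimeRing' R)
    (hacc : ACCLeftAnnihilators R) {a : R} (ha : ∀ r, IsNilpotent (r * a)) : a = 0 := by
  refine h.eq_zero_of_nil_right hacc fun r => ?_
  obtain ⟨n, hn⟩ := ha r
  refine ⟨n + 1, ?_⟩
  rw [pow_succ, ← mul_assoc, mul_pow_mul, hn]
  simp

/-- A semiprime ring with a.c.c. on left annihilators is left nonsingular. -/
theorem IsSemiprimeRing'.eq_zero_of_essential_torsionOf (h : IsSemiprimeRing' R)
    (hacc : ACCLeftAnnihilators R) {x : R} (hx : IsEssentialLeftIdeal (Ideal.torsionOf R R x)) :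
    x = 0 := by
  refine h.eq_zero_of_nil_right hacc fun r => ?_
  obtain ⟨n, hn⟩ := hacc.exists_pow (x * r)
  refine ⟨n + 1, ?_⟩
  by_contra hne
  refine hx (Ideal.span {(x * r) ^ (n + 1)}) (by simpa using hne) ((Submodule.eq_bot_iff _).mpr ?_)
  rintro y ⟨hy, hyb⟩
  obtain ⟨s, rfl⟩ := Ideal.mem_span_singleton'.mp hyb
  refine hn s ?_
  have hy' : s * (x * r) ^ (n + 1) * x = 0 := hy
  calc s * ((x * r) ^ (n + 1) * (x * r) ^ (n + 1))
      = s * (x * r) ^ (n + 1) * x * (r * (x * r) ^ n) := by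
        rw [pow_succ' (x * r) n]; simp only [mul_assoc]
    _ = 0 := by rw [hy', zero_mul]

theorem IsEssentialLeftIdeal.mono {I J : Ideal R} (hI : IsEssentialLeftIdeal I) (hIJ : I ≤ J) :
    IsEssentialLeftIdeal J :=
  fun L hL h => hI L hL (le_bot_iff.mp (h ▸ inf_le_inf_right L hIJ))

theorem IsLeftGoldieRing.exists_torsionOf_inf_eq_bot (h : IsSemiprimeRing' R)
    (hg : IsLeftGoldieRing R) (E : Ideal R) : ∃ c ∈ E, E ⊓ Ideal.torsionOf R R c = ⊥ := by
  by_contra! hcon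
  have step : ∀ c : {c // c ∈ E ∧ ∀ r, r * (c * c) = 0 → r * c = 0},
      ∃ a, (a ∈ E ∧ a ≠ 0 ∧ a * c = 0 ∧ ∀ r, r * (a * a) = 0 → r * a = 0) ∧
        ∀ r, r * ((c + a) * (c + a)) = 0 → r * c.1 = 0 ∧ r * a = 0 := by
    rintro ⟨c, hcE, hc⟩
    obtain ⟨x, ⟨hxE, hxc⟩, hx0⟩ := Submodule.exists_mem_ne_zero_of_ne_bot (hcon c hcE)
    have hxc : x * c = 0 := hxc
    obtain ⟨r, hr⟩ : ∃ r, ¬ IsNilpotent (r * x) := by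
      by_contra! hnil
      exact hx0 (h.eq_zero_of_nil_left hg.2 hnil)
    obtain ⟨n, hn⟩ := hg.2.exists_pow (r * x)
    have hac : (r * x) ^ (n + 1) * c = 0 := by
      rw [pow_succ, mul_assoc, mul_assoc, hxc, mul_zero, mul_zero]
    refine ⟨(r * x) ^ (n + 1), ⟨?_, fun h0 => hr ⟨_, h0⟩, hac, hn⟩, fun s hs => ?_⟩
    · rw [pow_succ]
      exact E.mul_mem_left _ (E.mul_mem_left _ hxE)
    generalize (r * x) ^ (n + 1) = a at hac hn hs
    have hs' : s * (c * c) + (s * (c * a) + s * (a * a)) = 0 := by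
      rw [← hs]
      simp only [add_mul, mul_add, hac, mul_zero]
      abel
    have hsc : s * c = 0 := by
      refine hc s (hc (s * c) ?_ |> fun h => by rwa [mul_assoc] at h)
      have := congrArg (· * c) hs'
      simp only [add_mul, zero_mul] at this
      simpa [mul_assoc, hac] using this
    refine ⟨hsc, hn s ?_⟩
    rw [← mul_assoc s c c, ← mul_assoc s c a, hsc, zero_mul, zero_mul, zero_add, zero_add] at hs'
    exact hs'
  choose a ha hca using step
  let next : {c // c ∈ E ∧ ∀ r, r * (c * c) = 0 → r * c = 0} →
      {c // c ∈ E ∧ ∀ r, r * (c * c) = 0 → r * c = 0} := fun c =>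
    ⟨c + a c, E.add_mem c.2.1 (ha c).1, fun r hr => by
      rw [mul_add, (hca c r hr).1, (hca c r hr).2, add_zero]⟩
  let c : ℕ → {c // c ∈ E ∧ ∀ r, r * (c * c) = 0 → r * c = 0} :=
    fun n => next^[n] ⟨0, E.zero_mem, fun r _ => mul_zero r⟩
  have hsucc : ∀ n, (c (n + 1)).1 = c n + a (c n) := fun n => by
    simp only [c, Function.iterate_succ_apply', next]
  have hann : ∀ n r, r * (c (n + 1)).1 = 0 → r * (c n).1 = 0 ∧ r * a (c n) = 0 := fun n r hr => by
    refine hca (c n) r ?_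
    rw [← hsucc, ← mul_assoc, hr, zero_mul]
  refine hg.1 ⟨fun n => Ideal.span {a (c n)}, fun n => by simpa using (ha (c n)).2.1,
    iSupIndep_of_antitone_filtration _ (fun n => Ideal.torsionOf R R (c n).1)
      (antitone_nat_of_succ_le fun n r hr => (hann n r hr).1) (fun n => ?_) fun n => ?_⟩
  · rw [Ideal.span_singleton_le_iff_mem]
    exact (ha (c n)).2.2.1
  · rw [Submodule.disjoint_def]
    intro y hy hy'
    obtain ⟨s, rfl⟩ := Ideal.mem_span_singleton'.mp hy
    refine (ha (c n)).2.2.2 s ?_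
    rw [← mul_assoc]
    exact (hann n _ hy').2

theorem HasFiniteLeftUniformDimension.isEssentialLeftIdeal_span_singleton
    (h : HasFiniteLeftUniformDimension R) {c : R} (hc : ∀ r, r * c = 0 → r = 0) :
    IsEssentialLeftIdeal (Ideal.span {c}) := by
  intro I hI hbot
  have hpow : ∀ n r, r * c ^ n = 0 → r = 0 := by
    intro n
    induction n with
    | zero => simp
    | succ n ih => exact fun r hr => ih r (hc _ (by rwa [pow_succ, ← mul_assoc] at hr))
  refine h ⟨fun n => Submodule.map (LinearMap.toSpanSingleton R R (c ^ n)) I, fun n h0 => hI ?_,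
    iSupIndep_of_antitone_filtration _ (fun n => Ideal.span {c ^ n})
      (antitone_nat_of_succ_le fun n => ?_) (fun n => ?_) fun n => ?_⟩
  · rw [Submodule.eq_bot_iff]
    intro x hx
    exact hpow n x ((Submodule.eq_bot_iff _).mp h0 _ ⟨x, hx, rfl⟩)
  · rw [Ideal.span_singleton_le_iff_mem, Ideal.mem_span_singleton']
    exact ⟨c, (pow_succ' c n).symm⟩
  · rintro _ ⟨x, -, rfl⟩
    exact Ideal.mem_span_singleton'.mpr ⟨x, rfl⟩
  · rw [Submodule.disjoint_def]
    rintro _ ⟨x, hx, rfl⟩ hy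
    obtain ⟨s, hs⟩ := Ideal.mem_span_singleton'.mp hy
    have hxs : x = s * c := by
      refine sub_eq_zero.mp (hpow n _ ?_)
      rw [sub_mul, mul_assoc, ← pow_succ', hs]
      exact sub_self _
    have : x ∈ Ideal.span {c} ⊓ I := ⟨Ideal.mem_span_singleton'.mpr ⟨s, hxs.symm⟩, hx⟩
    rw [hbot, Submodule.mem_bot] at this
    rw [this, map_zero]

/-- **Goldie**: an essential left ideal of a semiprime left Goldie ring contains a regular
element. -/
theorem IsLeftGoldieRing.exists_isRegular_mem (h : IsSemiprimeRing' R)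
    (hg : IsLeftGoldieRing R) {E : Ideal R} (hE : IsEssentialLeftIdeal E) :
    ∃ c ∈ E, IsRegular c := by
  obtain ⟨c, hcE, hc⟩ := hg.exists_torsionOf_inf_eq_bot h E
  have hann : Ideal.torsionOf R R c = ⊥ := by
    by_contra hne
    exact hE _ hne hc
  have hleft : ∀ r, r * c = 0 → r = 0 := fun r hr => by
    have : r ∈ Ideal.torsionOf R R c := hr
    rwa [hann] at this
  refine ⟨c, hcE, isLeftRegular_iff_right_eq_zero_of_mul.mpr fun x hx => ?_,
    isRightRegular_iff_left_eq_zero_of_mul.mpr hleft⟩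
  refine h.eq_zero_of_essential_torsionOf hg.2
    ((hg.1.isEssentialLeftIdeal_span_singleton hleft).mono ?_)
  rw [Ideal.span_singleton_le_iff_mem]
  exact hx

theorem exists_disjoint_isEssentialLeftIdeal_sup (I : Ideal R) :
    ∃ J : Ideal R, Disjoint I J ∧ IsEssentialLeftIdeal (I ⊔ J) := by
  obtain ⟨J, -, hJ⟩ := zorn_le_nonempty₀ {J : Ideal R | Disjoint I J}
    (fun C hC hchain _ _ => ⟨sSup C, (hchain.directedOn.disjoint_sSup_right).mpr hC,
      fun _ => le_sSup⟩) ⊥ disjoint_bot_right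
  refine ⟨J, hJ.prop, fun L hL hbot => hL ?_⟩
  have hdisj : Disjoint I (J ⊔ L) :=
    hJ.prop.disjoint_sup_right_of_disjoint_sup_left (disjoint_iff.mpr hbot)
  have hle : L ≤ J := le_sup_right.trans (hJ.le_of_ge hdisj le_sup_left)
  rw [← inf_eq_right.mpr (hle.trans le_sup_right : L ≤ I ⊔ J), hbot]

/-- **Goldie's Theorem**: the classical left quotient ring of a semiprime left Goldie ring is
semisimple. -/
theorem IsLeftLocalization.isSemisimpleRing {Q : Type*} [Ring Q] {θ : R →+* Q}
    (hloc : IsLeftLocalization {r : R | IsRegular r} θ) (h : IsSemiprimeRing' R)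
    (hg : IsLeftGoldieRing R) : IsSemisimpleRing Q := by
  refine (isSemisimpleModule_iff Q Q).mpr ⟨fun I => ?_⟩
  obtain ⟨J, hdisj, hess⟩ := exists_disjoint_isEssentialLeftIdeal_sup I
  refine ⟨J, hdisj, codisjoint_iff.mpr ?_⟩
  have hE : IsEssentialLeftIdeal (Ideal.comap θ (I ⊔ J)) := by
    intro L hL hbot
    obtain ⟨a, haL, ha⟩ := Submodule.exists_mem_ne_zero_of_ne_bot hL
    have ha' : θ a ≠ 0 := fun h0 => ha <| by
      obtain ⟨s, hs, hsa⟩ := (hloc.ker_eq a).mp h0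
      exact isLeftRegular_iff_right_eq_zero_of_mul.mp hs.left a hsa
    refine hess (Ideal.span {θ a}) (by simpa using ha') ((Submodule.eq_bot_iff _).mpr ?_)
    rintro y ⟨hy, hya⟩
    obtain ⟨q, rfl⟩ := Ideal.mem_span_singleton'.mp hya
    obtain ⟨c, hc, r, hcr⟩ := hloc.exists_rep q
    have hmem : r * a ∈ Ideal.comap θ (I ⊔ J) ⊓ L := by
      refine ⟨?_, L.mul_mem_left r haL⟩
      change θ (r * a) ∈ I ⊔ J
      rw [map_mul, ← hcr, mul_assoc]
      exact Ideal.mul_mem_left _ _ hy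
    rw [hbot, Submodule.mem_bot] at hmem
    rw [← (hloc.isUnit c hc).mul_right_eq_zero, ← mul_assoc, hcr, ← map_mul, hmem, map_zero]
  obtain ⟨c, hcE, hc⟩ := hg.exists_isRegular_mem h hE
  exact Ideal.eq_top_of_isUnit_mem _ hcE (hloc.isUnit c hc)

end Goldie

section Semisimple

variable {Q : Type*} [Ring Q] [IsSemisimpleRing Q]

theorem IsSemisimpleRing.exists_mul_mul_eq_self (m : Q) : ∃ a, m * a * m = m := by
  obtain ⟨J, hJ⟩ := exists_isCompl (Ideal.span {m})
  obtain ⟨g, hg, e, he, hge⟩ := Submodule.mem_sup.mp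
    (hJ.sup_eq_top ▸ Submodule.mem_top : (1 : Q) ∈ Ideal.span {m} ⊔ J)
  obtain ⟨a, rfl⟩ := Ideal.mem_span_singleton'.mp hg
  refine ⟨a, ?_⟩
  have hm : m * a * m + m * e = m := by rw [mul_assoc, ← mul_add, hge, mul_one]
  have hme : m * e = 0 := by
    refine Submodule.disjoint_def.mp hJ.disjoint _ ?_ (J.mul_mem_left m he)
    rw [eq_sub_of_add_eq' hm]
    exact sub_mem (Ideal.mem_span_singleton_self m)
      (Ideal.mul_mem_left _ _ (Ideal.mem_span_singleton_self m))
  rwa [hme, add_zero] at hm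

theorem IsSemisimpleRing.isUnit_of_isRightRegular {x : Q} (hx : ∀ y, y * x = 0 → y = 0) :
    IsUnit x := by
  obtain ⟨b, hb⟩ := IsArtinian.surjective_of_injective_endomorphism
    (LinearMap.toSpanSingleton Q Q x) ((injective_iff_map_eq_zero _).mpr hx) 1
  have hb : b * x = 1 := hb
  refine ⟨⟨x, b, ?_, hb⟩, rfl⟩
  refine sub_eq_zero.mp (hx _ ?_)
  rw [sub_mul, mul_assoc, hb, mul_one, one_mul, sub_self]

/-- The kernel of a ring homomorphism from a semisimple ring is generated by a central
idempotent. -/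
theorem IsSemisimpleRing.exists_central_mem_ker {A : Type*} [Ring A] (Φ : Q →+* A) :
    ∃ f : Q, Φ f = 0 ∧ (∀ k, Φ k = 0 → f * k = k) ∧ ∀ q, f * q = q * f := by
  obtain ⟨J, hJ⟩ := exists_isCompl (RingHom.ker Φ)
  obtain ⟨f, hf, e, he, hfe⟩ := Submodule.mem_sup.mp
    (hJ.sup_eq_top ▸ Submodule.mem_top : (1 : Q) ∈ RingHom.ker Φ ⊔ J)
  rw [RingHom.mem_ker] at hf
  have hKJ : ∀ k j, Φ k = 0 → j ∈ J → k * j = 0 := fun k j hk hj =>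
    Submodule.disjoint_def.mp hJ.disjoint _ (by rw [RingHom.mem_ker, map_mul, hk, zero_mul])
      (J.mul_mem_left k hj)
  have hright : ∀ k, Φ k = 0 → k * f = k := fun k hk => by
    calc k * f = k * f + k * e := by rw [hKJ k e hk he, add_zero]
      _ = k := by rw [← mul_add, hfe, mul_one]
  have hleft : ∀ k, Φ k = 0 → f * k = k := fun k hk => by
    obtain ⟨a, ha⟩ := IsSemisimpleRing.exists_mul_mul_eq_self (e * k)
    have h0 : e * k = 0 := by
      rw [← ha, mul_assoc e, mul_assoc e, mul_assoc k, ← mul_assoc a, ← mul_assoc k,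
        hKJ k (a * e) hk (J.mul_mem_left a he), zero_mul, mul_zero]
    calc f * k = f * k + e * k := by rw [h0, add_zero]
      _ = k := by rw [← add_mul, hfe, one_mul]
  refine ⟨f, hf, hleft, fun q => ?_⟩
  rw [← hright (f * q) (by rw [map_mul, hf, zero_mul]), mul_assoc,
    hleft (q * f) (by rw [map_mul, hf, mul_zero])]

/-- A ring endomorphism of a semisimple ring is a split epimorphism onto its range. -/
theorem IsSemisimpleRing.exists_section_range (Φ : Q →+* Q) :
    ∃ s : Φ.range →+* Q, ∀ x : Φ.range, Φ (s x) = (x : Q) := by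
  obtain ⟨f, hf, hfk, hcomm⟩ := IsSemisimpleRing.exists_central_mem_ker Φ
  have hff : ∀ b, f * (f * b) = f * b := fun b => by rw [← mul_assoc, hfk f hf]
  have hleft : ∀ a b, a * (f * b) = f * (a * b) := fun a b => by
    rw [← mul_assoc, ← hcomm, mul_assoc]
  have hmul : ∀ a b c d, (f * a + (1 - f) * b) * (f * c + (1 - f) * d) =
      f * (a * c) + (1 - f) * (b * d) := fun a b c d => by
    simp only [add_mul, sub_mul, mul_add, mul_sub, one_mul, mul_assoc, hleft a, hleft b, hff]
    abel
  have key : ∀ a b : Q, Φ a = Φ b → (1 - f) * a = (1 - f) * b := fun a b hab => by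
    have := hfk (a - b) (by rw [map_sub, hab, sub_self])
    rw [← sub_eq_zero, ← mul_sub, sub_mul, this, one_mul, sub_self]
  choose g hg using fun x : Φ.range => x.2
  refine ⟨{ toFun := fun x => f * x + (1 - f) * g x, map_one' := ?_, map_mul' := fun x y => ?_,
            map_zero' := ?_, map_add' := fun x y => ?_ }, fun x => ?_⟩
  · rw [key (g 1) 1 (by rw [hg, map_one]; rfl)]
    simp
  · rw [hmul, key (g (x * y)) (g x * g y) (by rw [hg, map_mul, hg, hg]; rfl)]
    rfl
  · rw [key (g 0) 0 (by rw [hg, map_zero]; rfl)]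
    simp
  · rw [key (g (x + y)) (g x + g y) (by rw [hg, map_add, hg, hg]; rfl), Subring.coe_add,
      mul_add, mul_add]
    abel
  · change Φ (f * x + (1 - f) * g x) = x
    simp [hf, hg]

/-- A semisimple ring is the product of the kernel and the range of any ring homomorphism
defined on it. -/
theorem IsSemisimpleRing.exists_ringEquiv_ker_prod_range {A : Type*} [Ring A] (Φ : Q →+* A) :
    ∃ K : NonUnitalSubring Q, (K : Set Q) = {q : Q | Φ q = 0} ∧
      Nonempty (Q ≃+* (K × Φ.range)) := by
  obtain ⟨f, hf, hfk, hcomm⟩ := IsSemisimpleRing.exists_central_mem_ker Φ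
  let K : NonUnitalSubring Q :=
    { carrier := {q | Φ q = 0}
      zero_mem' := map_zero Φ
      add_mem' := fun {a b} (ha : Φ a = 0) (hb : Φ b = 0) => by
        change Φ (a + b) = 0
        rw [map_add, ha, hb, add_zero]
      neg_mem' := fun {a} (ha : Φ a = 0) => by
        change Φ (-a) = 0
        rw [map_neg, ha, neg_zero]
      mul_mem' := fun {a b} (ha : Φ a = 0) _ => by
        change Φ (a * b) = 0
        rw [map_mul, ha, zero_mul] }
  have hK : ∀ q, f * q ∈ K := fun q => by
    change Φ (f * q) = 0
    rw [map_mul, hf, zero_mul]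
  let F : Q → K × Φ.range := fun q => (⟨f * q, hK q⟩, Φ.rangeRestrict q)
  have hbij : Function.Bijective F := by
    constructor
    · intro a b hab
      have h1 : f * a = f * b := congrArg (fun z => (z.1 : Q)) hab
      have h2 : Φ a = Φ b := congrArg (fun z => (z.2 : A)) hab
      have := hfk (a - b) (by rw [map_sub, h2, sub_self])
      rwa [mul_sub, h1, sub_self, eq_comm, sub_eq_zero] at this
    · rintro ⟨⟨k, hk⟩, ⟨_, q, rfl⟩⟩
      have hk : Φ k = 0 := hk
      refine ⟨k + (q - f * q), Prod.ext (Subtype.ext ?_) (Subtype.ext ?_)⟩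
      · change f * (k + (q - f * q)) = k
        rw [mul_add, mul_sub, hfk k hk, hfk (f * q) (hK q), sub_self, add_zero]
      · change Φ (k + (q - f * q)) = Φ q
        simp [hk, hf]
  refine ⟨K, rfl, ⟨{ Equiv.ofBijective F hbij with
    map_mul' := fun a b => Prod.ext (Subtype.ext ?_) (map_mul Φ.rangeRestrict a b)
    map_add' := fun a b => Prod.ext (Subtype.ext (mul_add f a b))
      (map_add Φ.rangeRestrict a b) }⟩⟩
  change f * (a * b) = f * a * (f * b)
  rw [hcomm a, mul_assoc, ← mul_assoc f f, hfk f hf, ← mul_assoc, ← mul_assoc, hcomm a]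

end Semisimple

namespace IsLeftLocalization

variable {R Q : Type*} [Ring R] [Ring Q] {θ : R →+* Q}

theorem hom_ext {S : Set R} (hloc : IsLeftLocalization S θ) {T : Type*} [Ring T] {Φ Ψ : Q →+* T}
    (h : ∀ r, Φ (θ r) = Ψ (θ r)) : Φ = Ψ := by
  ext q
  obtain ⟨c, hc, r, hr⟩ := hloc.exists_rep q
  refine ((hloc.isUnit c hc).map Φ).mul_left_cancel ?_
  rw [← map_mul, hr, h c, ← map_mul, hr, h]

theorem injective (hloc : IsLeftLocalization {r : R | IsRegular r} θ) :
    Function.Injective θ := by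
  rw [injective_iff_map_eq_zero]
  intro a ha
  obtain ⟨s, hs, hsa⟩ := (hloc.ker_eq a).mp ha
  exact isLeftRegular_iff_right_eq_zero_of_mul.mp hs.left a hsa

open nonZeroDivisors in
/-- The universal property of the classical left quotient ring. -/
theorem exists_lift_s6 (hloc : IsLeftLocalization {r : R | IsRegular r} θ) {T : Type*} [Ring T]
    (g : R →+* T) (hg : ∀ c, IsRegular c → IsUnit (g c)) :
    ∃ Φ : Q →+* T, ∀ r, Φ (θ r) = g r := by
  have hS : ∀ s : R⁰, IsRegular (s : R) := fun s => isRegular_iff_mem_nonZeroDivisors.mpr s.2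
  obtain ⟨_⟩ : Nonempty (OreLocalization.OreSet R⁰) := by
    rw [OreLocalization.nonempty_oreSet_iff]
    refine ⟨fun r₁ r₂ s h => ⟨1, by rw [(hS s).right h]⟩, fun r s => ?_⟩
    obtain ⟨u, hu⟩ := hloc.isUnit s (hS s)
    obtain ⟨c, hc, r', h⟩ := hloc.exists_rep (θ r * ↑u⁻¹)
    refine ⟨r', ⟨c, isRegular_iff_mem_nonZeroDivisors.mp hc⟩, hloc.injective ?_⟩
    rw [map_mul, map_mul, ← h, ← hu]
    simp [mul_assoc]
  have ⟨u, hu⟩ : ∃ u : R⁰ →* Qˣ, ∀ s : R⁰, θ s = u s :=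
    ⟨IsUnit.liftRight ((θ : R →* Q).comp R⁰.subtype) fun s => hloc.isUnit s (hS s), fun _ => rfl⟩
  have ⟨v, hv⟩ : ∃ v : R⁰ →* Tˣ, ∀ s : R⁰, g s = v s :=
    ⟨IsUnit.liftRight ((g : R →* T).comp R⁰.subtype) fun s => hg s (hS s), fun _ => rfl⟩
  let ι := OreLocalization.universalHom θ u hu
  let γ := OreLocalization.universalHom g v hv
  have hι : Function.Bijective ι := by
    constructor
    · rw [injective_iff_map_eq_zero]
      intro x hx
      induction x using OreLocalization.ind with | _ r s
      rw [OreLocalization.universalHom_apply, Units.mul_right_eq_zero] at hx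
      rw [hloc.injective (hx.trans (map_zero θ).symm), OreLocalization.zero_oreDiv]
    · intro q
      obtain ⟨c, hc, r, h⟩ := hloc.exists_rep q
      refine ⟨OreLocalization.oreDiv r ⟨c, isRegular_iff_mem_nonZeroDivisors.mp hc⟩, ?_⟩
      rw [OreLocalization.universalHom_apply, Units.inv_mul_eq_iff_eq_mul, ← hu]
      exact h.symm
  let e := RingEquiv.ofBijective ι hι
  refine ⟨γ.comp e.symm.toRingHom, fun r => ?_⟩
  have : e.symm (θ r) = OreLocalization.numeratorHom r := by
    rw [RingEquiv.symm_apply_eq]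
    exact (OreLocalization.universalHom_commutes θ u hu).symm
  change γ (e.symm (θ r)) = g r
  rw [this]
  exact OreLocalization.universalHom_commutes g v hv

end IsLeftLocalization

/-- **Theorem 2.2.(2).** Let `R` be a semiprime left Goldie ring with classical left
quotient ring `Q = Q_l(R)` (realized by `θ : R →+* Q`), and let `σ` be a ring
endomorphism of `R` with `σ(C_R) ⊆ C_R`.  Then `σ` extends uniquely to a ring
endomorphism `Φ` of `Q` (with `Φ ∘ θ = θ ∘ σ`), given by `c⁻¹r ↦ σ(c)⁻¹σ(r)`; this
extension is a split epimorphism of `Q` onto its range, `Q ≅ ker Φ × Φ(Q)` as rings, and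
the range `Φ(Q) = σ(Q_l(R))` is the classical left quotient ring `Q_l(σ(R))` of `σ(R)`
(via the restriction of `θ`). -/
theorem extension_to_quotient_ring_split_epi {R : Type u} {Q : Type v} [Ring R] [Ring Q]
    (hsemiprime : IsSemiprimeRing' R) (hgoldie : IsLeftGoldieRing R)
    (σ : R →+* R) (hreg : ∀ c : R, IsRegular c → IsRegular (σ c))
    (θ : R →+* Q) (hloc : IsLeftLocalization {r : R | IsRegular r} θ) :
    (∃! Φ : Q →+* Q, ∀ r : R, Φ (θ r) = θ (σ r)) ∧
    ∀ Φ : Q →+* Q, (∀ r : R, Φ (θ r) = θ (σ r)) →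
      -- `Φ` is given by `c⁻¹ r ↦ σ(c)⁻¹ σ(r)`:
      ((∀ (c r : R), IsRegular c → ∀ u v : Qˣ, (u : Q) = θ c → (v : Q) = θ (σ c) →
          Φ ((↑u⁻¹ : Q) * θ r) = (↑v⁻¹ : Q) * θ (σ r)) ∧
      -- `Φ` is a split epimorphism of `Q` onto its range:
      (∃ s : Φ.range →+* Q, ∀ x : Φ.range, Φ (s x) = (x : Q)) ∧
      -- `Q ≅ ker Φ × Φ(Q)` as rings:
      (∃ K : NonUnitalSubring Q, (K : Set Q) = {q : Q | Φ q = 0} ∧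
        Nonempty (Q ≃+* (K × Φ.range))) ∧
      -- `Φ(Q) = σ(Q_l(R))` is the classical left quotient ring of `σ(R)`:
      (∃ θ' : σ.range →+* Φ.range,
        (∀ x : σ.range, (θ' x : Q) = θ (x : R)) ∧
        IsLeftLocalization {x : σ.range | IsRegular x} θ')) := by
  have hss : IsSemisimpleRing Q := hloc.isSemisimpleRing hsemiprime hgoldie
  have hunit : ∀ c, IsRegular c → IsUnit (θ (σ c)) := fun c hc => hloc.isUnit _ (hreg c hc)
  constructor
  · obtain ⟨Φ, hΦ⟩ := hloc.exists_lift_s6 (θ.comp σ) hunit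
    exact ⟨Φ, hΦ, fun Ψ hΨ => hloc.hom_ext fun r => (hΨ r).trans (hΦ r).symm⟩
  · intro Φ hΦ
    refine ⟨fun c r hc u v hu hv => ?_, IsSemisimpleRing.exists_section_range Φ,
      IsSemisimpleRing.exists_ringEquiv_ker_prod_range Φ,
      (θ.comp σ.range.subtype).codRestrict Φ.range ?_, fun _ => rfl, ?_, ?_, ?_⟩
    · rw [Units.eq_inv_mul_iff_mul_eq, hv, ← hΦ, ← hu, ← map_mul, Units.mul_inv_cancel_left, hΦ]
    · rintro ⟨_, r, rfl⟩
      exact ⟨θ r, hΦ r⟩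
    · have hssr : IsSemisimpleRing Φ.range :=
        Φ.rangeRestrict.isSemisimpleRing_of_surjective Φ.rangeRestrict_surjective
      rintro x hx
      refine IsSemisimpleRing.isUnit_of_isRightRegular ?_
      rintro ⟨_, q, rfl⟩ hy
      have hy : Φ q * θ x = 0 := congrArg Subtype.val hy
      obtain ⟨c, hc, r, h⟩ := hloc.exists_rep q
      have hcr : θ (σ c) * Φ q = θ (σ r) := by rw [← hΦ, ← map_mul, h, hΦ]
      have hrx : σ r * x = 0 := hloc.injective <| by
        rw [map_mul, ← hcr, mul_assoc, hy, mul_zero, map_zero]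
      have hr : σ r = 0 := congrArg Subtype.val
        (isRightRegular_iff_left_eq_zero_of_mul.mp hx.right ⟨σ r, r, rfl⟩ (Subtype.ext hrx))
      refine Subtype.ext ((hunit c hc).mul_right_eq_zero.mp ?_)
      rw [hcr, hr, map_zero]
    · intro x
      constructor
      · intro hx
        have hx : θ x = θ 0 := (congrArg Subtype.val hx).trans (map_zero θ).symm
        exact ⟨1, isRegular_one, by rw [one_mul]; exact Subtype.ext (hloc.injective hx)⟩
      · rintro ⟨s, hs, hsx⟩
        rw [isLeftRegular_iff_right_eq_zero_of_mul.mp hs.left x hsx, map_zero]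
    · rintro ⟨_, q, rfl⟩
      obtain ⟨c, hc, r, h⟩ := hloc.exists_rep q
      refine ⟨⟨σ c, c, rfl⟩, ⟨fun a b hab => Subtype.ext ((hreg c hc).left ?_),
        fun a b hab => Subtype.ext ((hreg c hc).right ?_)⟩, ⟨σ r, r, rfl⟩, Subtype.ext ?_⟩
      · exact congrArg Subtype.val hab
      · exact congrArg Subtype.val hab
      · change θ (σ c) * Φ q = θ (σ r)
        rw [← hΦ, ← map_mul, h, hΦ]
end
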